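/- Let T: C → D be a cellular functor, let F₁, F₂: D → E be functors to a category E, and let φ: F₁ ⟹ F₂ be a natural transformation. Then there exists a unique triple consisting of a functor F_φ: D → E and natural transformations φ₁: F₁ ⟹ F_φ and φ₂: F_φ ⟹ F₂ with φ₂ ∘ φ₁ = φ, such that F_φ(d) = F₂(d) and φ₂(d) = id_{F₂(d)} for every object d of D not in the image of T, and F_φ(T(c)) = F₁(T(c)) and φ₁(T(c)) = id_{F₁(T(c))} for every object c of C. -/

import Mathlib

open CategoryTheory

/-- A functor `T : C ⥤ D` is *cellular* if it is fully faithful, injective on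
objects, and for every object `d` of `D` not in the image of `T` and every object
`c` of `C` there are no morphisms `d ⟶ T(c)`. -/
def IsCellular {C D : Type} [SmallCategory C] [SmallCategory D] (T : C ⥤ D) : Prop :=
  T.Full ∧ T.Faithful ∧ Function.Injective T.obj ∧
    ∀ d : D, (∀ c : C, T.obj c ≠ d) → ∀ c : C, IsEmpty (d ⟶ T.obj c)

namespace CellularFactorization

variable {D E : Type*} [Category D] [Category E] {F₁ F₂ : D ⥤ E} {φ : F₁ ⟶ F₂}

/-- A natural transformation `φ` with a pointwise factorization through objects `X d`, whose first
factor is invertible on a sieve of objects `p` and whose second factor is invertible off `p`,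
factors through a functor with values `X`. -/
lemma exists_functor_of_pointwise {p : D → Prop} (hp : ∀ {d d' : D}, (d ⟶ d') → p d' → p d)
    {X : D → E} (a : ∀ d, F₁.obj d ⟶ X d) (b : ∀ d, X d ⟶ F₂.obj d)
    (hab : ∀ d, a d ≫ b d = φ.app d) (ha : ∀ d, p d → IsIso (a d))
    (hb : ∀ d, ¬ p d → IsIso (b d)) :
    ∃ (m : ∀ {d d' : D}, (d ⟶ d') → (X d ⟶ X d')),
      (∀ d, m (𝟙 d) = 𝟙 (X d)) ∧
      (∀ {d d' d'' : D} (f : d ⟶ d') (g : d' ⟶ d''), m (f ≫ g) = m f ≫ m g) ∧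
      (∀ {d d' : D} (f : d ⟶ d'), F₁.map f ≫ a d' = a d ≫ m f) ∧
      (∀ {d d' : D} (f : d ⟶ d'), m f ≫ b d' = b d ≫ F₂.map f) := by
  have key : ∀ {d d' : D} (f : d ⟶ d'), ∃! g : X d ⟶ X d',
      F₁.map f ≫ a d' = a d ≫ g ∧ g ≫ b d' = b d ≫ F₂.map f := by
    intro d d' f
    have sq : F₁.map f ≫ a d' ≫ b d' = a d ≫ b d ≫ F₂.map f := by
      rw [hab, ← Category.assoc, hab, φ.naturality]
    by_cases h : p d
    · have := ha d h
      refine ⟨inv (a d) ≫ F₁.map f ≫ a d', ⟨by simp, ?_⟩, ?_⟩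
      · simp [sq]
      · rintro g ⟨hg, -⟩
        simp [hg]
    · have := hb d' fun h' => h (hp f h')
      refine ⟨b d ≫ F₂.map f ≫ inv (b d'), ⟨?_, by simp⟩, ?_⟩
      · rw [← cancel_mono (b d')]
        simp [sq]
      · rintro g ⟨-, hg⟩
        rw [← cancel_mono (b d')]
        simp [hg]
  choose m hm hu using @key
  refine ⟨m, fun d => ?_, fun f g => ?_, fun f => ?_, fun f => ?_⟩
  · exact (hu (𝟙 d) _ ⟨by simp, by simp⟩).symm
  · refine (hu (f ≫ g) _ ⟨?_, ?_⟩).symm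
    · rw [F₁.map_comp, Category.assoc, (hm g).1, ← Category.assoc, (hm f).1, Category.assoc]
    · rw [F₂.map_comp, Category.assoc, (hm g).2, ← Category.assoc, (hm f).2, Category.assoc]
  · exact (hm f).1
  · exact (hm f).2

/-- Two factorizations of `φ` whose first factors are identities on a sieve of objects `p` and
whose second factors are identities off `p` are equal. -/
lemma factorization_unique {p : D → Prop} (hp : ∀ {d d' : D}, (d ⟶ d') → p d' → p d)
    {G G' : D ⥤ E} {a : F₁ ⟶ G} {b : G ⟶ F₂} {a' : F₁ ⟶ G'} {b' : G' ⟶ F₂}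
    (hab : a ≫ b = φ) (hab' : a' ≫ b' = φ)
    (ha : ∀ d, p d → ∃ h : F₁.obj d = G.obj d, a.app d = eqToHom h)
    (hb : ∀ d, ¬ p d → ∃ h : G.obj d = F₂.obj d, b.app d = eqToHom h)
    (ha' : ∀ d, p d → ∃ h : F₁.obj d = G'.obj d, a'.app d = eqToHom h)
    (hb' : ∀ d, ¬ p d → ∃ h : G'.obj d = F₂.obj d, b'.app d = eqToHom h) :
    (⟨G, a, b⟩ : Σ H : D ⥤ E, (F₁ ⟶ H) × (H ⟶ F₂)) = ⟨G', a', b'⟩ := by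
  have habd (d : D) : a.app d ≫ b.app d = a'.app d ≫ b'.app d := by
    rw [← NatTrans.comp_app, ← NatTrans.comp_app, hab, hab']
  have hobj (d : D) : G.obj d = G'.obj d := by
    by_cases h : p d
    · exact (ha d h).1.symm.trans (ha' d h).1
    · exact (hb d h).1.trans (hb' d h).1.symm
  have hfst (d : D) : a'.app d = a.app d ≫ eqToHom (hobj d) := by
    by_cases h : p d
    · obtain ⟨e, he⟩ := ha d h
      obtain ⟨e', he'⟩ := ha' d h
      simp [he, he']
    · obtain ⟨e, he⟩ := hb d h
      obtain ⟨e', he'⟩ := hb' d h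
      have := habd d
      rw [he, he'] at this
      rw [← cancel_mono (eqToHom e'), ← this]
      simp
  have hsnd (d : D) : b.app d = eqToHom (hobj d) ≫ b'.app d := by
    by_cases h : p d
    · obtain ⟨e, he⟩ := ha d h
      have : IsIso (a.app d) := he ▸ inferInstance
      rw [← cancel_epi (a.app d), habd, hfst, Category.assoc]
    · obtain ⟨e, he⟩ := hb d h
      obtain ⟨e', he'⟩ := hb' d h
      simp [he, he']
  have hG : G = G' := by
    refine CategoryTheory.Functor.ext hobj fun d d' f => ?_
    by_cases h : p d
    · obtain ⟨e, he⟩ := ha d h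
      have : IsIso (a.app d) := he ▸ inferInstance
      have nat := a'.naturality f
      rw [hfst, hfst, ← Category.assoc, a.naturality, Category.assoc, Category.assoc,
        cancel_epi] at nat
      rw [← reassoc_of% nat]
      simp
    · obtain ⟨e, he⟩ := hb' d' fun h' => h (hp f h')
      have : IsIso (b'.app d') := he ▸ inferInstance
      have nat := b.naturality f
      rw [hsnd, hsnd, Category.assoc, ← b'.naturality, ← Category.assoc, ← Category.assoc,
        cancel_mono] at nat
      rw [← reassoc_of% nat]
      simp
  subst hG
  obtain rfl : a = a' := by
    ext d
    simp [hfst]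
  obtain rfl : b = b' := by
    ext d
    simp [hsnd]
  rfl

/-- A natural transformation factors through a functor agreeing with its source on a sieve of
objects `p` and with its target off `p`. -/
lemma exists_factorization {p : D → Prop} (hp : ∀ {d d' : D}, (d ⟶ d') → p d' → p d)
    (φ : F₁ ⟶ F₂) :
    ∃ (G : D ⥤ E) (a : F₁ ⟶ G) (b : G ⟶ F₂), a ≫ b = φ ∧
      (∀ d, p d → ∃ h : F₁.obj d = G.obj d, a.app d = eqToHom h) ∧
      (∀ d, ¬ p d → ∃ h : G.obj d = F₂.obj d, b.app d = eqToHom h) := by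
  have pointwise (d : D) : ∃ (X : E) (a : F₁.obj d ⟶ X) (b : X ⟶ F₂.obj d),
      a ≫ b = φ.app d ∧ (p d → ∃ h : F₁.obj d = X, a = eqToHom h) ∧
      (¬ p d → ∃ h : X = F₂.obj d, b = eqToHom h) := by
    by_cases h : p d
    · exact ⟨F₁.obj d, 𝟙 _, φ.app d, by simp, fun _ => ⟨rfl, rfl⟩, fun h' => absurd h h'⟩
    · exact ⟨F₂.obj d, φ.app d, 𝟙 _, by simp, fun h' => absurd h' h, fun _ => ⟨rfl, rfl⟩⟩
  choose X a b hab ha hb using pointwise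
  obtain ⟨m, m_id, m_comp, nat_a, nat_b⟩ := exists_functor_of_pointwise hp a b hab
    (fun d h => by obtain ⟨e, he⟩ := ha d h; rw [he]; infer_instance)
    (fun d h => by obtain ⟨e, he⟩ := hb d h; rw [he]; infer_instance)
  let G : D ⥤ E := { obj := X, map := m, map_id := m_id, map_comp := m_comp }
  exact ⟨G, { app := a, naturality := fun _ _ => nat_a },
    { app := b, naturality := fun _ _ => nat_b }, NatTrans.ext (funext hab), ha, hb⟩

end CellularFactorization

/-- STATEMENT 6: if `T : C ⥤ D` is cellular, `F₁, F₂ : D ⥤ E` are functors and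
`φ : F₁ ⟹ F₂` is a natural transformation, then there is a unique triple
`(F_φ, φ₁ : F₁ ⟹ F_φ, φ₂ : F_φ ⟹ F₂)` with `φ₂ ∘ φ₁ = φ`, such that
`F_φ(d) = F₂(d)` and `φ₂(d) = id` for `d` not in the image of `T`, and
`F_φ(T(c)) = F₁(T(c))` and `φ₁(T(c)) = id` for every object `c` of `C`. -/
theorem cellular_unique_factorization {C D : Type} [SmallCategory C]
    [SmallCategory D] {E : Type*} [Category E] {T : C ⥤ D} (hT : IsCellular T)
    (F₁ F₂ : D ⥤ E) (φ : F₁ ⟶ F₂) :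
    ∃! P : Σ Fφ : D ⥤ E, (F₁ ⟶ Fφ) × (Fφ ⟶ F₂),
      P.2.1 ≫ P.2.2 = φ ∧
      (∀ d : D, (∀ c : C, T.obj c ≠ d) →
        ∃ h : P.1.obj d = F₂.obj d, P.2.2.app d = eqToHom h) ∧
      (∀ c : C, ∃ h : F₁.obj (T.obj c) = P.1.obj (T.obj c),
        P.2.1.app (T.obj c) = eqToHom h) := by
  obtain ⟨-, -, -, hempty⟩ := hT
  have hp {d d' : D} (f : d ⟶ d') : (∃ c, T.obj c = d') → ∃ c, T.obj c = d := by
    rintro ⟨c, rfl⟩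
    by_contra! h
    exact (hempty d h c).false f
  obtain ⟨G, a, b, hab, ha, hb⟩ :=
    CellularFactorization.exists_factorization (p := fun d => ∃ c, T.obj c = d) hp φ
  refine ⟨⟨G, a, b⟩, ⟨hab, fun d h => hb d (not_exists.mpr h), fun c => ha _ ⟨c, rfl⟩⟩, ?_⟩
  rintro ⟨G', a', b'⟩ ⟨hab', hb', ha'⟩
  refine CellularFactorization.factorization_unique hp hab' hab ?_
    (fun d h => hb' d (not_exists.mp h)) ha hb
  rintro _ ⟨c, rfl⟩
  exact ha' c
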